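/- arXiv:1903.00697 — 4 statements merged into one kernel-verified Lean document; each statement's English description precedes it below -/
import Mathlib

section
/- Let G be a nontrivial finite group and Y a nonempty subset of G. Then D(Y) ≥ √((1/#Y − 1/#G)/(#G − 1)), and equality holds if and only if ∂_ρ(Y)/dim ρ = √((1/#Y − 1/#G)/(#G − 1)) for every nontrivial irreducible complex representation ρ of G. -/
open Finset CategoryTheory

/-- `∂_ρ(Y) = √( (dim ρ)/((#Y)²·#G) · ∑_{x,y ∈ Y} χ_ρ(x⁻¹y) )`. -/
noncomputable def dPar {G : Type} [Group G] [Fintype G] (V : FDRep ℂ G) (Y : Finset G) : ℝ :=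
  Real.sqrt ((Module.finrank ℂ V : ℝ) / ((Y.card : ℝ) ^ 2 * (Fintype.card G : ℝ)) *
    (∑ x ∈ Y, ∑ y ∈ Y, V.character (x⁻¹ * y)).re)

open scoped MonoidAlgebra

/-- The representation on an irreducible space is simple as an object of `FDRep`. -/
theorem Representation.IsIrreducible.simple_fdRep_of {G V : Type} [Group G] [Fintype G]
    [AddCommGroup V] [Module ℂ V] [FiniteDimensional ℂ V] (ρ : Representation ℂ G V)
    [ρ.IsIrreducible] : Simple (FDRep.of ρ) := by
  have := invertibleOfNonzero (NeZero.ne (Nat.card G : ℂ))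
  rw [FDRep.simple_iff_char_is_norm_one]
  have h := Representation.card_inv_mul_sum_char_mul_char_eq_finrank ρ ρ
  rw [Representation.IsIrreducible.finrank_intertwiningMap_self, Nat.cast_one,
    inv_mul_eq_one₀ (NeZero.ne _)] at h
  exact h.symm

/-- By Schur's lemma, the average of an irreducible representation against a class function
orthogonal to its character vanishes. -/
theorem Representation.IsIrreducible.sum_smul_eq_zero {G V : Type} [Group G] [Fintype G]
    [AddCommGroup V] [Module ℂ V] [FiniteDimensional ℂ V] (ρ : Representation ℂ G V)
    [ρ.IsIrreducible] (f : G → ℂ) (hf : ∀ g h, f (h * g * h⁻¹) = f g)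
    (h0 : ∑ g, f g * ρ.character g = 0) : ∑ g, f g • ρ g = 0 := by
  let T : ρ.IntertwiningMap ρ := ⟨∑ g, f g • ρ g, fun h ↦ by
    simp only [LinearMap.ext_iff, LinearMap.comp_apply, LinearMap.sum_apply, LinearMap.smul_apply,
      map_sum, map_smul]
    intro v
    refine Fintype.sum_equiv (MulAut.conj h⁻¹).toEquiv _ _ fun g ↦ ?_
    have : f (h⁻¹ * (g * h)) = f g := by simpa [mul_assoc] using hf g h⁻¹
    simp [this, ← Module.End.mul_apply, ← map_mul, mul_assoc]⟩
  obtain ⟨c, hc⟩ := (Representation.IsIrreducible.algebraMap_intertwiningMap_bijective_of_isAlgClosed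
    (ρ := ρ)).2 T
  have hT : ∑ g, f g • ρ g = c • (1 : Module.End ℂ V) := by
    ext v
    have := congrArg (fun S : ρ.IntertwiningMap ρ ↦ S v) hc
    exact this.symm
  have htr := congrArg (LinearMap.trace ℂ V) hT
  simp only [map_sum, map_smul, LinearMap.trace_one, smul_eq_mul] at htr
  have hdim : (Module.finrank ℂ V : ℂ) ≠ 0 := by
    have := ρ.irreducible_iff_isSimpleModule_asModule.1 inferInstance
    have : Nontrivial V := IsSimpleModule.nontrivial ℂ[G] ρ.asModule
    exact_mod_cast Module.finrank_pos.ne'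
  have : c = 0 := by
    have h1 : c * (Module.finrank ℂ V : ℂ) = 0 := htr.symm.trans h0
    simpa [hdim] using h1
  rw [hT, this, zero_smul]

/-- A class function orthogonal to all irreducible characters vanishes. -/
theorem eq_zero_of_forall_sum_mul_character_eq_zero {G : Type} [Group G] [Fintype G]
    (f : G → ℂ) (hf : ∀ g h, f (h * g * h⁻¹) = f g)
    (h0 : ∀ V : FDRep ℂ G, Simple V → ∑ g, f g * V.character g = 0) : f = 0 := by
  classical
  let a : ℂ[G] := ∑ g, MonoidAlgebra.single g (f g)
  have ha : ∀ x : ℂ[G], x ∈ (⊤ : Submodule ℂ[G] ℂ[G]) → a • x = 0 := by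
    intro x hx
    rw [← IsSemisimpleModule.sSup_simples_eq_top ℂ[G] ℂ[G], sSup_eq_iSup'] at hx
    refine Submodule.iSup_induction _ (motive := fun x ↦ a • x = 0) hx ?_ (smul_zero a)
      fun x y hx hy ↦ by rw [smul_add, hx, hy, add_zero]
    rintro ⟨S, hS : IsSimpleModule ℂ[G] S⟩ x hx
    let ρ : Representation ℂ G S := Representation.ofModule' S
    have hρ (b : ℂ[G]) (y : S) : ρ.asAlgebraHom b y = b • y := by
      simp [ρ, Representation.ofModule', Representation.asAlgebraHom_def]
    let e : ρ.asModule ≃ₗ[ℂ[G]] S :=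
      { ρ.asModuleEquiv.toAddEquiv with
        map_smul' := fun b y ↦ (ρ.asModuleEquiv_map_smul b y).trans (hρ b _) }
    have : ρ.IsIrreducible :=
      ρ.irreducible_iff_isSimpleModule_asModule.2 (IsSimpleModule.congr e)
    have : FiniteDimensional ℂ S :=
      inferInstanceAs (FiniteDimensional ℂ (S.restrictScalars ℂ))
    have hz := Representation.IsIrreducible.sum_smul_eq_zero ρ f hf
      (h0 (FDRep.of ρ) (Representation.IsIrreducible.simple_fdRep_of ρ))
    have ha0 : ρ.asAlgebraHom a = 0 := by
      rw [← hz]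
      simp [a]
    have := hρ a ⟨x, hx⟩
    rw [ha0] at this
    exact congrArg Subtype.val this.symm
  have h1 : a = 0 := by simpa using ha 1 trivial
  ext g
  have := congrArg (fun b : ℂ[G] ↦ b.coeff g) h1
  simpa [a, Finsupp.single_apply, Finsupp.finsetSum_apply] using this

/-- The character of the regular representation: column orthogonality at the identity. -/
theorem sum_finrank_mul_character {G : Type} [Group G] [Fintype G] [DecidableEq G]
    {ι : Type} [Fintype ι] (Φ : ι → FDRep ℂ G)
    (hsimple : ∀ i, Simple (Φ i))
    (hdistinct : ∀ i j, i ≠ j → IsEmpty (Φ i ≅ Φ j))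
    (hcomplete : ∀ W : FDRep ℂ G, Simple W → ∃ i, Nonempty (Φ i ≅ W)) (g : G) :
    ∑ i, (Module.finrank ℂ (Φ i) : ℂ) * (Φ i).character g =
      if g = 1 then (Fintype.card G : ℂ) else 0 := by
  classical
  have := invertibleOfNonzero (NeZero.ne (Nat.card G : ℂ))
  have horth (i j : ι) : ∑ g, (Φ j).character g * (Φ i).character g⁻¹ =
      if i = j then (Fintype.card G : ℂ) else 0 := by
    have := hsimple i
    have := hsimple j
    have h := FDRep.char_orthonormal (Φ j) (Φ i)
    rw [inv_mul_eq_iff_eq_mul₀ (NeZero.ne _)] at h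
    rw [h, Nat.card_eq_fintype_card]
    by_cases hij : i = j
    · subst hij
      simp [Nonempty.intro (Iso.refl (Φ i))]
    · simp [hij, hdistinct j i (Ne.symm hij)]
  have key := eq_zero_of_forall_sum_mul_character_eq_zero
    (fun g : G ↦ ∑ i, (Module.finrank ℂ (Φ i) : ℂ) * (Φ i).character g⁻¹ -
      if g = 1 then (Fintype.card G : ℂ) else 0)
    (fun g h ↦ by
      have (i : ι) : (Φ i).character (h * g * h⁻¹)⁻¹ = (Φ i).character g⁻¹ := by
        rw [← FDRep.char_conj (Φ i) g⁻¹ h]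
        simp [mul_assoc]
      simp only [this, conj_eq_one_iff])
    (fun V hV ↦ by
      obtain ⟨j, ⟨e⟩⟩ := hcomplete V hV
      rw [← FDRep.char_iso e]
      simp only [sub_mul, sum_mul, sum_sub_distrib]
      rw [sum_comm]
      have (i : ι) : ∑ g, (Module.finrank ℂ (Φ i) : ℂ) * (Φ i).character g⁻¹ *
          (Φ j).character g = if i = j then
            (Module.finrank ℂ (Φ i) : ℂ) * (Fintype.card G : ℂ) else 0 := by
        simp_rw [mul_assoc, ← mul_sum, mul_comm ((Φ i).character _), horth, mul_ite, mul_zero]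
      simp only [this]
      simp [mul_comm])
  have := congrFun key g⁻¹
  simpa [sub_eq_zero] using this

/-- If a weighted mean of `r ^ 2` is at least `c ^ 2`, then the supremum of `r` is at least `c`,
with equality only for constant `r`. -/
theorem le_iSup_and_iSup_eq_iff_of_weighted_sq {κ : Type*} [Fintype κ] [Nonempty κ] (w r : κ → ℝ)
    (c : ℝ) (hw : ∀ i, 0 < w i) (hr : ∀ i, 0 ≤ r i) (hc : 0 ≤ c)
    (h : (∑ i, w i) * c ^ 2 ≤ ∑ i, w i * r i ^ 2) :
    c ≤ ⨆ i, r i ∧ ((⨆ i, r i) = c ↔ ∀ i, r i = c) := by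
  have hle (i : κ) : r i ≤ ⨆ i, r i := le_ciSup (Set.finite_range r).bddAbove i
  rw [sum_mul] at h
  refine ⟨?_, fun hs i ↦ ?_, fun hs ↦ by simp [hs]⟩
  · obtain ⟨i, -, hi⟩ := exists_le_of_sum_le univ_nonempty h
    exact ((sq_le_sq₀ hc (hr i)).1 (le_of_mul_le_mul_left hi (hw i))).trans (hle i)
  · rw [hs] at hle
    have hle' : ∀ i ∈ univ, w i * r i ^ 2 ≤ w i * c ^ 2 := fun i _ ↦
      mul_le_mul_of_nonneg_left ((sq_le_sq₀ (hr i) hc).2 (hle i)) (hw i).le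
    have := (sum_eq_sum_iff_of_le hle').1 (le_antisymm (sum_le_sum hle') h) i (mem_univ i)
    exact (sq_eq_sq₀ (hr i) hc).1 (mul_left_cancel₀ (hw i).ne' this)

theorem stmt3 {G : Type} [Group G] [Fintype G] [Nontrivial G]
    (Y : Finset G) (hY : Y.Nonempty)
    -- `Φ` is a complete family of pairwise non-isomorphic irreducible representations of `G`,
    -- i.e. it enumerates the isomorphism classes of irreducible representations:
    {ι : Type} [Fintype ι] [DecidableEq ι] (Φ : ι → FDRep ℂ G)
    (hsimple : ∀ i, Simple (Φ i))
    (hdistinct : ∀ i j, i ≠ j → IsEmpty (Φ i ≅ Φ j))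
    (hcomplete : ∀ W : FDRep ℂ G, Simple W → ∃ i, Nonempty (Φ i ≅ W))
    -- `i₀` is the index of the trivial representation `1_G`:
    (i₀ : ι) (hi₀ : ∀ g : G, (Φ i₀).character g = 1) :
    (⨆ i : {i : ι // i ≠ i₀}, dPar (Φ i) Y / (Module.finrank ℂ (Φ i) : ℝ)) ≥
        Real.sqrt ((1 / (Y.card : ℝ) - 1 / (Fintype.card G : ℝ)) / ((Fintype.card G : ℝ) - 1)) ∧
    ((⨆ i : {i : ι // i ≠ i₀}, dPar (Φ i) Y / (Module.finrank ℂ (Φ i) : ℝ)) =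
        Real.sqrt ((1 / (Y.card : ℝ) - 1 / (Fintype.card G : ℝ)) / ((Fintype.card G : ℝ) - 1)) ↔
      ∀ i : ι, i ≠ i₀ → dPar (Φ i) Y / (Module.finrank ℂ (Φ i) : ℝ) =
        Real.sqrt ((1 / (Y.card : ℝ) - 1 / (Fintype.card G : ℝ)) / ((Fintype.card G : ℝ) - 1))) := by
  classical
  have hn : (0 : ℝ) < Y.card := by exact_mod_cast hY.card_pos
  have hnN : (Y.card : ℝ) ≤ Fintype.card G := by exact_mod_cast card_le_univ Y
  have hN1 : (0 : ℝ) < (Fintype.card G : ℝ) - 1 := by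
    rw [sub_pos]
    exact_mod_cast Fintype.one_lt_card (α := G)
  have hN : (0 : ℝ) < Fintype.card G := hn.trans_le hnN
  have hd (i : ι) : (0 : ℝ) < Module.finrank ℂ (Φ i) := by
    rcases Nat.eq_zero_or_pos (Module.finrank ℂ (Φ i)) with h | h
    · have := hsimple i
      have h1 := (FDRep.simple_iff_char_is_norm_one (Φ i)).1 this
      have : Subsingleton (Φ i) := Module.finrank_zero_iff.1 h
      have h0 (g : G) : (Φ i).character g = 0 := by
        rw [FDRep.character, Subsingleton.elim ((Φ i).ρ g) 0, map_zero]
      simp only [h0, mul_zero, sum_const_zero] at h1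
      exact absurd h1.symm (NeZero.ne _)
    · exact_mod_cast h
  have hreg := sum_finrank_mul_character Φ hsimple hdistinct hcomplete
  have hd₀ : (Module.finrank ℂ (Φ i₀) : ℝ) = 1 := by
    have := hi₀ 1
    rw [FDRep.char_one] at this
    exact_mod_cast this
  have hsplit (f : ι → ℝ) : ∑ i : {i // i ≠ i₀}, f i = ∑ i, f i - f i₀ := by
    rw [eq_sub_iff_add_eq', Fintype.sum_eq_add_sum_subtype_ne f i₀]
  have hsq : ∑ i : {i // i ≠ i₀}, (Module.finrank ℂ (Φ i) : ℝ) ^ 2 = (Fintype.card G : ℝ) - 1 := by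
    rw [hsplit (fun i ↦ (Module.finrank ℂ (Φ i) : ℝ) ^ 2), hd₀, one_pow]
    have := hreg 1
    simp only [FDRep.char_one, if_true, ← sq] at this
    rw [sub_left_inj]
    exact_mod_cast this
  have hcharsum : ∑ i, (Module.finrank ℂ (Φ i) : ℝ) *
      (∑ x ∈ Y, ∑ y ∈ Y, (Φ i).character (x⁻¹ * y)).re = Y.card * Fintype.card G := by
    have h : ∑ i, (Module.finrank ℂ (Φ i) : ℂ) * ∑ x ∈ Y, ∑ y ∈ Y, (Φ i).character (x⁻¹ * y) =
        Y.card * Fintype.card G := by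
      simp_rw [mul_sum]
      rw [sum_comm]
      have (x : G) (hx : x ∈ Y) : ∑ i, ∑ y ∈ Y, (Module.finrank ℂ (Φ i) : ℂ) *
          (Φ i).character (x⁻¹ * y) = Fintype.card G := by
        rw [sum_comm]
        simp [hreg, inv_mul_eq_one, hx]
      rw [sum_congr rfl this]
      simp
    have := congrArg Complex.re h
    rw [← Nat.cast_mul, Complex.natCast_re, Complex.re_sum] at this
    simpa [← Complex.ofReal_natCast, Complex.re_ofReal_mul] using this
  have hmean : ∑ i : {i // i ≠ i₀}, (Module.finrank ℂ (Φ i) : ℝ) /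
      ((Y.card : ℝ) ^ 2 * (Fintype.card G : ℝ)) *
      (∑ x ∈ Y, ∑ y ∈ Y, (Φ i).character (x⁻¹ * y)).re =
      1 / (Y.card : ℝ) - 1 / (Fintype.card G : ℝ) := by
    rw [hsplit (fun i ↦ (Module.finrank ℂ (Φ i) : ℝ) /
      ((Y.card : ℝ) ^ 2 * (Fintype.card G : ℝ)) *
      (∑ x ∈ Y, ∑ y ∈ Y, (Φ i).character (x⁻¹ * y)).re)]
    simp_rw [div_mul_eq_mul_div]
    rw [← sum_div, hcharsum, hd₀]
    simp only [hi₀, sum_const, nsmul_eq_mul, mul_one, Complex.mul_re, Complex.natCast_re,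
      Complex.natCast_im, one_mul, mul_zero, sub_zero]
    field_simp
  have : Nonempty {i // i ≠ i₀} := by
    by_contra hemp
    rw [not_nonempty_iff] at hemp
    rw [univ_eq_empty, sum_empty] at hsq
    exact hN1.ne hsq
  have hc : 0 ≤ (1 / (Y.card : ℝ) - 1 / (Fintype.card G : ℝ)) / ((Fintype.card G : ℝ) - 1) :=
    div_nonneg (sub_nonneg.2 (one_div_le_one_div_of_le hn hnN)) hN1.le
  have key := le_iSup_and_iSup_eq_iff_of_weighted_sq
    (fun i : {i // i ≠ i₀} ↦ (Module.finrank ℂ (Φ i) : ℝ) ^ 2)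
    (fun i ↦ dPar (Φ i) Y / (Module.finrank ℂ (Φ i) : ℝ)) _
    (fun i ↦ pow_pos (hd i) 2) (fun i ↦ div_nonneg (Real.sqrt_nonneg _) (hd i).le)
    (Real.sqrt_nonneg ((1 / (Y.card : ℝ) - 1 / (Fintype.card G : ℝ)) /
      ((Fintype.card G : ℝ) - 1))) (by
    rw [hsq, Real.sq_sqrt hc, mul_div_cancel₀ _ hN1.ne', ← hmean]
    refine sum_le_sum fun i _ ↦ ?_
    rw [div_pow, mul_div_cancel₀ _ (pow_pos (hd i) 2).ne']
    exact (le_max_left _ 0).trans_eq (Real.sq_sqrt' (x := _)).symm)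
  simpa only [Subtype.forall] using key
end

section
/- Let G be a nontrivial finite group and Y a nonempty subset of G. Then λ_{[a]}(Y)/#[a] = ((#Y)² − #Y)/(#G − 1) holds for every a ∈ G with a ≠ 1 if and only if ∂_ρ(Y)/dim ρ = √((1/#Y − 1/#G)/(#G − 1)) holds for every nontrivial irreducible complex representation ρ of G. -/
open Finset CategoryTheory

/-- The conjugacy class `[a]` of `a`, as a finset. -/
noncomputable def conjCl {G : Type} [Group G] [Fintype G] (a : G) : Finset G :=
  letI := Classical.decPred (IsConj a)
  Finset.univ.filter (fun b => IsConj a b)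

/-- `λ_{[a]}(Y) = #{(x,y) ∈ Y×Y : x⁻¹y ∈ [a]}`. -/
noncomputable def lamConj {G : Type} [Group G] [Fintype G] (Y : Finset G) (a : G) : ℕ :=
  letI := Classical.decPred fun p : G × G => IsConj a (p.1⁻¹ * p.2)
  ((Y ×ˢ Y).filter (fun p => IsConj a (p.1⁻¹ * p.2))).card

/-- A representation over `ℂ` that is irreducible gives a simple object of `FDRep`. -/
lemma simple_of_isIrreducible {G : Type} [Group G] [Fintype G] {V : Type} [AddCommGroup V]
    [Module ℂ V] [Module.Finite ℂ V] (ρ : Representation ℂ G V) [ρ.IsIrreducible] :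
    Simple (FDRep.of ρ) := by
  have := invertibleOfNonzero (NeZero.ne (Nat.card G : ℂ))
  rw [FDRep.simple_iff_char_is_norm_one]
  have h := Representation.char_orthonormal ρ ρ
  rw [if_pos ⟨Representation.Equiv.refl ρ⟩, inv_mul_eq_one₀ (NeZero.ne _)] at h
  exact h.symm

lemma finrank_pos_of_simple {G : Type} [Group G] [Fintype G] (V : FDRep ℂ G) [hV : Simple V] :
    0 < Module.finrank ℂ V := by
  have h := (FDRep.simple_iff_char_is_norm_one V).1 hV
  by_contra h0
  have : Subsingleton V := (Module.finrank_zero_iff (R := ℂ)).1 (by omega)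
  have h1 (g : G) : V.character g = 0 := by
    rw [FDRep.character, Subsingleton.elim (V.ρ g) 0, map_zero]
  simp [h1] at h
  exact absurd h.symm (by simp)

lemma sum_character_eq_zero {G : Type} [Group G] [Fintype G] (V : FDRep ℂ G) [Simple V]
    (hV : ¬ ∀ g : G, V.character g = 1) : ∑ g : G, V.character g = 0 := by
  have := invertibleOfNonzero (NeZero.ne (Nat.card G : ℂ))
  let W : FDRep ℂ G := FDRep.of (Representation.trivial ℂ G ℂ)
  have hW (g : G) : W.character g = 1 := by
    have : W.character g = LinearMap.trace ℂ ℂ 1 := rfl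
    rw [this, LinearMap.trace_one]; simp
  have : Simple W := by
    rw [FDRep.simple_iff_char_is_norm_one]
    simp [hW]
  have h := FDRep.char_orthonormal V W
  rw [if_neg] at h
  · simpa [hW] using h
  · rintro ⟨i⟩
    exact hV fun g => by rw [FDRep.char_iso i, hW]

/-- The element `∑ g, H g • g` of the group algebra. -/
noncomputable def groupAlgebraSum {G : Type} [Group G] [Fintype G] (H : G → ℂ) :
    MonoidAlgebra ℂ G :=
  ∑ g, MonoidAlgebra.single g (H g)

/-- A class function orthogonal to an irreducible character acts by zero, by Schur's lemma. -/
lemma asAlgebraHom_groupAlgebraSum_eq_zero {G : Type} [Group G] [Fintype G] {H : G → ℂ}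
    (hH : ∀ g h, H (h * g * h⁻¹) = H g) {V : Type} [AddCommGroup V]
    [Module ℂ V] [Module.Finite ℂ V] (ρ : Representation ℂ G V) [ρ.IsIrreducible]
    (h0 : ∑ g, H g * ρ.character g = 0) :
    ρ.asAlgebraHom (groupAlgebraSum H) = 0 := by
  have hT : ρ.asAlgebraHom (groupAlgebraSum H) = ∑ g, H g • ρ g := by
    simp [groupAlgebraSum, Representation.asAlgebraHom_single]
  have hcomm (x : G) : (∑ g, H g • ρ g) ∘ₗ ρ x = ρ x ∘ₗ (∑ g, H g • ρ g) := by
    change (∑ g, H g • ρ g) * ρ x = ρ x * (∑ g, H g • ρ g)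
    rw [Finset.sum_mul, Finset.mul_sum]
    symm
    refine Fintype.sum_equiv (MulAut.conj x).toEquiv _ _ fun g => ?_
    simp [hH, ← map_mul]
  let f : Representation.IntertwiningMap ρ ρ := ⟨∑ g, H g • ρ g, fun g => hcomm g⟩
  obtain ⟨c, hc⟩ :=
    (Representation.IsIrreducible.algebraMap_intertwiningMap_bijective_of_isAlgClosed (ρ := ρ)).2 f
  have hf : (∑ g, H g • ρ g) = c • (1 : V →ₗ[ℂ] V) := by
    change f.toLinearMap = _
    rw [← hc]; rfl
  have htr : LinearMap.trace ℂ V (∑ g, H g • ρ g) = 0 := by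
    simpa [Representation.character] using h0
  rw [hT]
  rw [hf] at htr ⊢
  simp only [map_smul, LinearMap.trace_one, smul_eq_mul, mul_eq_zero, Nat.cast_eq_zero] at htr
  rcases htr with h | h
  · simp [h]
  · have : Subsingleton V := Module.finrank_zero_iff.1 h
    exact Subsingleton.elim _ _

/-- A class function orthogonal to every irreducible character vanishes. -/
lemma eq_zero_of_orthogonal_characters {G : Type} [Group G] [Fintype G] {H : G → ℂ}
    (hH : ∀ g h, H (h * g * h⁻¹) = H g)
    (h0 : ∀ V : FDRep ℂ G, Simple V → ∑ g, H g * V.character g = 0) : H = 0 := by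
  classical
  have key : ∀ N : Submodule (MonoidAlgebra ℂ G) (MonoidAlgebra ℂ G),
      IsSimpleModule (MonoidAlgebra ℂ G) N → ∀ x ∈ N, groupAlgebraSum H * x = 0 := by
    intro N hN x hx
    let σ : Representation ℂ G N := Representation.ofModule' N
    have hσ (r : MonoidAlgebra ℂ G) (v : N) : σ.asAlgebraHom r v = r • v := by
      have : σ.asAlgebraHom = Algebra.lsmul ℂ ℂ N :=
        (MonoidAlgebra.lift ℂ (N →ₗ[ℂ] N) G).apply_symm_apply _
      rw [this]; rfl
    let e : σ.asModule ≃ₗ[MonoidAlgebra ℂ G] N :=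
      { σ.asModuleEquiv.toAddEquiv with
        map_smul' := fun r v => (σ.asModuleEquiv_map_smul r v).trans (hσ r _) }
    have hirr : σ.IsIrreducible :=
      (Representation.irreducible_iff_isSimpleModule_asModule σ).2 (IsSimpleModule.congr e)
    have : Module.Finite ℂ N :=
      Module.Finite.of_injective (N.subtype.restrictScalars ℂ) Subtype.val_injective
    have h := asAlgebraHom_groupAlgebraSum_eq_zero hH σ (h0 _ (simple_of_isIrreducible σ))
    have h2 := hσ (groupAlgebraSum H) ⟨x, hx⟩
    rw [h] at h2
    exact (congrArg Subtype.val h2).symm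
  have htop := IsSemisimpleModule.sSup_simples_eq_top (MonoidAlgebra ℂ G) (MonoidAlgebra ℂ G)
  have h1 : groupAlgebraSum H * 1 = 0 := by
    have hker : ∀ x ∈ sSup { m : Submodule (MonoidAlgebra ℂ G) (MonoidAlgebra ℂ G) |
        IsSimpleModule (MonoidAlgebra ℂ G) m }, groupAlgebraSum H * x = 0 := by
      intro x hx
      rw [sSup_eq_iSup'] at hx
      induction hx using Submodule.iSup_induction' with
      | mem i y hy => exact key i.1 i.2 y hy
      | zero => simp
      | add y z _ _ hy hz => rw [mul_add, hy, hz, add_zero]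
    exact hker 1 (by rw [htop]; trivial)
  rw [mul_one] at h1
  funext g
  have h2 := congrArg (fun z : MonoidAlgebra ℂ G => z.coeff g) h1
  simpa [groupAlgebraSum, MonoidAlgebra.coeff_sum, Finsupp.single_apply] using h2

open scoped ComplexOrder MatrixOrder Matrix in
/-- The double character sum over a finite set is the squared Frobenius norm of a matrix. -/
lemma exists_character_sum_eq_ofReal_nonneg {G : Type} [Group G] [Fintype G] (V : FDRep ℂ G)
    (Y : Finset G) :
    ∃ s : ℝ, 0 ≤ s ∧ ∑ x ∈ Y, ∑ y ∈ Y, V.character (x⁻¹ * y) = s := by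
  classical
  let b := Module.finBasis ℂ V
  let M (g : G) : Matrix _ _ ℂ := LinearMap.toMatrix b b (V.ρ g)
  have hmul (g h : G) : M (g * h) = M g * M h := by
    simp only [M, map_mul, LinearMap.toMatrix_mul]
  have hone : M 1 = 1 := by simp [M, LinearMap.toMatrix_one]
  let P := ∑ g, (M g)ᴴ * M g
  have hP : P.PosDef := by
    have h1 : P = (M 1)ᴴ * M 1 + ∑ g ∈ univ.erase 1, (M g)ᴴ * M g :=
      (Finset.add_sum_erase univ (fun g => (M g)ᴴ * M g) (mem_univ 1)).symm
    rw [h1, hone]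
    simp only [Matrix.conjTranspose_one, mul_one]
    exact Matrix.PosDef.one.add_posSemidef
      (Matrix.posSemidef_sum _ fun g _ => Matrix.posSemidef_conjTranspose_mul_self _)
  have hinv (x : G) : (M x)ᴴ * P * M x = P := by
    simp only [P, Finset.mul_sum, Finset.sum_mul]
    refine Fintype.sum_equiv (Equiv.mulRight x) _ _ fun g => ?_
    simp [hmul, Matrix.conjTranspose_mul, Matrix.mul_assoc]
  have hadj (x : G) : M x⁻¹ = P⁻¹ * (M x)ᴴ * P := by
    have h2 : M x * M x⁻¹ = 1 := by rw [← hmul, mul_inv_cancel, hone]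
    have h3 : (M x)ᴴ * P = P * M x⁻¹ := by
      calc (M x)ᴴ * P = (M x)ᴴ * P * (M x * M x⁻¹) := by rw [h2, mul_one]
        _ = P * M x⁻¹ := by rw [← Matrix.mul_assoc, hinv]
    rw [Matrix.mul_assoc, h3, ← Matrix.mul_assoc,
      Matrix.nonsing_inv_mul _ ((Matrix.isUnit_iff_isUnit_det _).1 hP.isUnit), one_mul]
  let A := ∑ y ∈ Y, M y
  have hsum : ∑ x ∈ Y, ∑ y ∈ Y, V.character (x⁻¹ * y) = (P⁻¹ * Aᴴ * P * A).trace := by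
    have hchar (g : G) : V.character g = (M g).trace :=
      LinearMap.trace_eq_matrix_trace ℂ b (V.ρ g)
    simp only [hchar, hmul, hadj, A, Matrix.conjTranspose_sum, Finset.mul_sum, Finset.sum_mul,
      Matrix.trace_sum]
    exact Finset.sum_comm
  obtain ⟨B, hB⟩ := CStarAlgebra.nonneg_iff_eq_star_mul_self.1 hP.posSemidef.nonneg
  obtain ⟨C, hC⟩ := CStarAlgebra.nonneg_iff_eq_star_mul_self.1 hP.inv.posSemidef.nonneg
  have : (P⁻¹ * Aᴴ * P * A).trace = ((B * A * Cᴴ)ᴴ * (B * A * Cᴴ)).trace := by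
    rw [hC, hB]
    simp only [Matrix.star_eq_conjTranspose]
    simp only [Matrix.conjTranspose_mul, Matrix.conjTranspose_conjTranspose, Matrix.mul_assoc]
    rw [Matrix.trace_mul_comm]
    simp only [Matrix.mul_assoc]
  rw [hsum, this]
  have h := Complex.nonneg_iff.1
    (Matrix.posSemidef_conjTranspose_mul_self (B * A * Cᴴ)).trace_nonneg
  exact ⟨_, h.1, Complex.ext rfl h.2.symm⟩

/-- The average of `λ_{[a]}(Y)` over the class `[a]`. -/
noncomputable def lamAvg {G : Type} [Group G] [Fintype G] (Y : Finset G) (a : G) : ℝ :=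
  (lamConj Y a : ℝ) / ((conjCl a).card : ℝ)

lemma mem_conjCl {G : Type} [Group G] [Fintype G] {a b : G} : b ∈ conjCl a ↔ IsConj a b := by
  simp only [conjCl, mem_filter, mem_univ, true_and]

lemma conjCl_congr {G : Type} [Group G] [Fintype G] {a b : G} (h : IsConj a b) :
    conjCl a = conjCl b := by
  ext c
  rw [mem_conjCl, mem_conjCl]
  exact ⟨fun hc => h.symm.trans hc, fun hc => h.trans hc⟩

lemma lamConj_congr {G : Type} [Group G] [Fintype G] (Y : Finset G) {a b : G} (h : IsConj a b) :
    lamConj Y a = lamConj Y b := by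
  classical
  unfold lamConj
  congr 1
  ext c
  simp only [mem_filter, and_congr_right_iff]
  exact fun _ => ⟨fun hc => h.symm.trans hc, fun hc => h.trans hc⟩

lemma card_conjCl_pos {G : Type} [Group G] [Fintype G] (a : G) : 0 < (conjCl a).card :=
  Finset.card_pos.2 ⟨a, mem_conjCl.2 (IsConj.refl a)⟩

lemma lamAvg_conj {G : Type} [Group G] [Fintype G] (Y : Finset G) (g h : G) :
    lamAvg Y (h * g * h⁻¹) = lamAvg Y g := by
  have hc : IsConj (h * g * h⁻¹) g := (isConj_iff.2 ⟨h, rfl⟩ : IsConj g _).symm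
  rw [lamAvg, lamAvg, conjCl_congr hc, lamConj_congr Y hc]

lemma lamAvg_one {G : Type} [Group G] [Fintype G] (Y : Finset G) :
    lamAvg Y (1 : G) = Y.card := by
  classical
  have h1 : (conjCl (1 : G)).card = 1 := by
    rw [Finset.card_eq_one]
    exact ⟨1, by ext b; rw [mem_conjCl, isConj_one_right, mem_singleton]⟩
  have h2 : lamConj Y (1 : G) = Y.card := by
    rw [← Finset.diag_card Y]
    unfold lamConj
    congr 1
    ext ⟨x, y⟩
    simp only [mem_filter, mem_product, isConj_one_right, mem_diag]
    constructor
    · rintro ⟨⟨hx, -⟩, h⟩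
      exact ⟨hx, inv_mul_eq_one.1 h⟩
    · rintro ⟨hx, rfl⟩
      simp [hx]
  rw [lamAvg, h1, h2]; simp

lemma sum_lamAvg_mul {G : Type} [Group G] [Fintype G] (Y : Finset G) {φ : G → ℂ}
    (hφ : ∀ g h, φ (h * g * h⁻¹) = φ g) :
    ∑ g, (lamAvg Y g : ℂ) * φ g = ∑ x ∈ Y, ∑ y ∈ Y, φ (x⁻¹ * y) := by
  classical
  have hlam (g : G) : (lamConj Y g : ℂ) =
      ∑ p ∈ Y ×ˢ Y, if IsConj g (p.1⁻¹ * p.2) then 1 else 0 := by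
    rw [Finset.sum_boole]
    unfold lamConj
    congr!
  have hcl (a : G) : ∑ g, (if IsConj g a then φ g / ((conjCl g).card : ℂ) else 0) = φ a := by
    have h1 (g : G) : (if IsConj g a then φ g / ((conjCl g).card : ℂ) else 0) =
        if g ∈ conjCl a then φ a / ((conjCl a).card : ℂ) else 0 := by
      by_cases h : IsConj g a
      · have h2 : g ∈ conjCl a := mem_conjCl.2 h.symm
        obtain ⟨c, hc⟩ := isConj_iff.1 h
        rw [if_pos h, if_pos h2, conjCl_congr h, ← hc, hφ]
      · have h2 : g ∉ conjCl a := fun h' => h (mem_conjCl.1 h').symm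
        rw [if_neg h, if_neg h2]
    have h3 : ((conjCl a).card : ℂ) ≠ 0 := by exact_mod_cast (card_conjCl_pos a).ne'
    simp only [h1]
    rw [Finset.sum_ite_mem, Finset.univ_inter, Finset.sum_const, nsmul_eq_mul]
    field_simp
  rw [← Finset.sum_product']
  simp only [← hcl (_⁻¹ * _)]
  rw [Finset.sum_comm]
  refine Finset.sum_congr rfl fun g _ => ?_
  simp only [lamAvg, Complex.ofReal_div, Complex.ofReal_natCast, hlam, Finset.sum_div,
    Finset.sum_mul]
  refine Finset.sum_congr rfl fun p _ => ?_
  split_ifs <;> simp [div_eq_mul_inv, mul_comm]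

theorem stmt5 {G : Type} [Group G] [Fintype G] [Nontrivial G]
    (Y : Finset G) (hY : Y.Nonempty) :
    (∀ a : G, a ≠ 1 → (lamConj Y a : ℝ) / ((conjCl a).card : ℝ) =
        ((Y.card : ℝ) ^ 2 - (Y.card : ℝ)) / ((Fintype.card G : ℝ) - 1)) ↔
      (∀ V : FDRep ℂ G, Simple V → ¬ (∀ g : G, V.character g = 1) →
        dPar V Y / (Module.finrank ℂ V : ℝ) =
          Real.sqrt ((1 / (Y.card : ℝ) - 1 / (Fintype.card G : ℝ)) /
            ((Fintype.card G : ℝ) - 1))) := by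
  classical
  set n : ℝ := (Fintype.card G : ℝ) with hn
  set m : ℝ := (Y.card : ℝ) with hm
  have hn1 : 1 < n := by rw [hn]; exact_mod_cast Fintype.one_lt_card (α := G)
  have hm0 : 0 < m := by rw [hm]; exact_mod_cast hY.card_pos
  have hmn : m ≤ n := by rw [hm, hn]; exact_mod_cast Finset.card_le_univ Y
  have hn1' : n - 1 ≠ 0 := by linarith
  set c : ℝ := (m ^ 2 - m) / (n - 1) with hc
  have hmc : m - c = m * (n - m) / (n - 1) := by rw [hc]; field_simp; ring
  have hsum (V : FDRep ℂ G) :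
      ∑ g, (lamAvg Y g : ℂ) * V.character g = ∑ x ∈ Y, ∑ y ∈ Y, V.character (x⁻¹ * y) :=
    sum_lamAvg_mul Y fun g h => V.char_conj g h
  have hB (V : FDRep ℂ G) (hV : Simple V) :
      dPar V Y / (Module.finrank ℂ V : ℝ) = √((1 / m - 1 / n) / (n - 1)) ↔
        ∑ g, (lamAvg Y g : ℂ) * V.character g = ((m - c : ℝ) : ℂ) * V.character 1 := by
    have hd : (0 : ℝ) < Module.finrank ℂ V := by exact_mod_cast finrank_pos_of_simple V
    rw [hsum, dPar, FDRep.char_one]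
    obtain ⟨s, hs0, hs⟩ :=
      exists_character_sum_eq_ofReal_nonneg V Y
    rw [hs, ← hn, ← hm]
    set d : ℝ := (Module.finrank ℂ V : ℝ) with hd'
    have hdc : (Module.finrank ℂ V : ℂ) = (d : ℂ) := by simp [hd']
    rw [hdc, Complex.ofReal_re, ← Complex.ofReal_mul, Complex.ofReal_inj, hmc]
    have hQ : 0 ≤ (1 / m - 1 / n) / (n - 1) :=
      div_nonneg (sub_nonneg.2 (one_div_le_one_div_of_le hm0 hmn)) (by linarith)
    have hn0 : 0 < n := by linarith
    rw [div_eq_iff hd.ne', ← Real.sqrt_sq hd.le, ← Real.sqrt_mul hQ, Real.sqrt_sq hd.le,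
      Real.sqrt_inj (by positivity) (by positivity)]
    have e1 : d / (m ^ 2 * n) * s - (1 / m - 1 / n) / (n - 1) * d ^ 2 =
        d / (m ^ 2 * n) * (s - m * (n - m) / (n - 1) * d) := by
      field_simp
    rw [← sub_eq_zero, e1, mul_eq_zero, sub_eq_zero]
    exact or_iff_right (by positivity)
  have hdecomp (φ : G → ℂ) (F : G → ℂ) :
      ∑ g, (F g - c - if g = 1 then ((m - c : ℝ) : ℂ) else 0) * φ g =
        ∑ g, F g * φ g - c * ∑ g, φ g - ((m - c : ℝ) : ℂ) * φ 1 := by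
    simp [sub_mul, Finset.sum_sub_distrib, Finset.mul_sum]
  let H (g : G) : ℂ := lamAvg Y g - c - if g = 1 then ((m - c : ℝ) : ℂ) else 0
  have hA : (∀ a : G, a ≠ 1 → lamAvg Y a = c) ↔ H = 0 := by
    constructor
    · intro h
      funext g
      by_cases hg : g = 1
      · subst hg; simp [H, lamAvg_one, hm]
      · simp [H, hg, h g hg]
    · intro h a ha
      have := congrFun h a
      simp only [H, if_neg ha, sub_zero, Pi.zero_apply, sub_eq_zero] at this
      exact_mod_cast this
  change (∀ a : G, a ≠ 1 → lamAvg Y a = c) ↔ _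
  rw [hA]
  constructor
  · intro h V hV hne
    have h1 := hdecomp V.character fun g => lamAvg Y g
    rw [sum_character_eq_zero V hne] at h1
    rw [hB V hV, ← sub_eq_zero]
    simpa [congrFun h] using
      (h1.symm.trans (Finset.sum_eq_zero fun g _ => by simpa [H] using Or.inl (congrFun h g)))
  · intro h
    refine eq_zero_of_orthogonal_characters (fun g x => ?_) fun V hV => ?_
    · simp only [H, lamAvg_conj, conj_eq_one_iff]
    · refine (hdecomp V.character fun g => lamAvg Y g).trans ?_
      by_cases hne : ∀ g : G, V.character g = 1
      · rw [hsum]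
        simp only [hne, Finset.sum_const, nsmul_eq_mul, mul_one, Finset.card_univ]
        have : m * m - c * n - (m - c) = 0 := by rw [hc]; field_simp; ring
        have h2 := congrArg Complex.ofReal this
        push_cast [hm, hn] at h2 ⊢
        exact h2
      · rw [(hB V hV).1 (h V hV hne), sum_character_eq_zero V hne]
        ring
end

section
/- Let G be a nontrivial finite group and Y a nonempty subset of G. If ∂_ρ(Y)/dim ρ is independent of the choice of the nontrivial irreducible complex representation ρ of G (up to isomorphism), then ∂_ρ(Y)/dim ρ = √((1/#Y − 1/#G)/(#G − 1)) for every nontrivial irreducible ρ; in particular, the two conditions are equivalent. -/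
open Finset CategoryTheory

namespace Representation

variable {G : Type*} [Group G]

open scoped Matrix ComplexOrder MatrixOrder in
/-- The double character sum over a subset of a finite group is the trace of a positive
semidefinite matrix. -/
theorem sum_character_inv_mul_nonneg [Fintype G] {V : Type*} [AddCommGroup V] [Module ℂ V]
    [FiniteDimensional ℂ V] (ρ : Representation ℂ G V) (Y : Finset G) :
    0 ≤ ∑ x ∈ Y, ∑ y ∈ Y, ρ.character (x⁻¹ * y) := by
  classical
  let b := Module.finBasis ℂ V
  let M : G → Matrix (Fin (Module.finrank ℂ V)) (Fin (Module.finrank ℂ V)) ℂ :=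
    fun g => LinearMap.toMatrix b b (ρ g)
  have hM_mul (g h : G) : M (g * h) = M g * M h := by
    simp only [M, map_mul, LinearMap.toMatrix_mul]
  have hM_one : M 1 = 1 := by
    simp only [M, map_one, LinearMap.toMatrix_one]
  let H := ∑ g : G, (M g)ᴴ * M g
  have hH_pos : H.PosDef := by
    refine Matrix.posDef_sum Finset.univ_nonempty fun g _ => ?_
    refine Matrix.PosDef.conjTranspose_mul_self _ (Matrix.mulVec_injective_of_isUnit ?_)
    exact IsUnit.of_mul_eq_one (M g⁻¹) (by rw [← hM_mul, mul_inv_cancel, hM_one])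
  have hH_unit : IsUnit H.det := (Matrix.isUnit_iff_isUnit_det _).mp hH_pos.isUnit
  have hH_inv (x : G) : (M x)ᴴ * H * M x = H := by
    simp only [H, Finset.mul_sum, Finset.sum_mul]
    refine Fintype.sum_equiv (Equiv.mulRight x) _ _ fun g => ?_
    simp only [Equiv.coe_mulRight, hM_mul, Matrix.conjTranspose_mul, Matrix.mul_assoc]
  have hM_inv (x : G) : M x⁻¹ = H⁻¹ * ((M x)ᴴ * H) := by
    have h : (M x)ᴴ * H = H * M x⁻¹ := by
      rw [← hH_inv x, Matrix.mul_assoc _ (M x), ← hM_mul, mul_inv_cancel, hM_one, mul_one,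
        hH_inv x]
    rw [h, ← Matrix.mul_assoc, Matrix.nonsing_inv_mul _ hH_unit, one_mul]
  let A := ∑ y ∈ Y, M y
  have hsum : ∑ x ∈ Y, ∑ y ∈ Y, ρ.character (x⁻¹ * y) = (H⁻¹ * (Aᴴ * H * A)).trace := by
    have hchar (g : G) : ρ.character g = (M g).trace := LinearMap.trace_eq_matrix_trace ℂ b (ρ g)
    simp only [A, Matrix.conjTranspose_sum, Finset.sum_mul, Finset.mul_sum, Matrix.trace_sum, hchar,
      hM_mul, hM_inv, Matrix.mul_assoc]
    exact Finset.sum_comm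
  obtain ⟨C, hC⟩ := CStarAlgebra.nonneg_iff_eq_star_mul_self.mp hH_pos.inv.posSemidef.nonneg
  rw [hsum, hC, Matrix.star_eq_conjTranspose, Matrix.mul_assoc, Matrix.trace_mul_comm]
  exact ((hH_pos.posSemidef.conjTranspose_mul_mul_same A).mul_mul_conjTranspose_same C).trace_nonneg

/-- The action of `G` on functions `G → ℂ` by right translation. -/
def rightTranslation (G : Type*) [Group G] : Representation ℂ G (G → ℂ) where
  toFun g := LinearMap.funLeft ℂ ℂ (· * g)
  map_one' := by ext; simp [LinearMap.funLeft]
  map_mul' g h := by ext; simp [LinearMap.funLeft, mul_assoc]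

theorem character_rightTranslation [Fintype G] [DecidableEq G] (g : G) :
    (rightTranslation G).character g = if g = 1 then (Fintype.card G : ℂ) else 0 := by
  rw [character, LinearMap.trace_eq_matrix_trace ℂ (Pi.basisFun ℂ G), Matrix.trace]
  have h (x : G) : (LinearMap.toMatrix (Pi.basisFun ℂ G) (Pi.basisFun ℂ G)
      (rightTranslation G g)).diag x = if g = 1 then 1 else 0 := by
    simp [rightTranslation, LinearMap.funLeft, Pi.single_apply]
  simp only [h]
  split_ifs <;> simp

theorem character_eq_add_of_isCompl {V : Type*} [AddCommGroup V] [Module ℂ V]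
    [FiniteDimensional ℂ V] {ρ : Representation ℂ G V} {S T : Subrepresentation ρ}
    (h : IsCompl S.toSubmodule T.toSubmodule) (g : G) :
    ρ.character g = S.toRepresentation.character g + T.toRepresentation.character g := by
  rw [character, character, character, ← LinearMap.trace_prodMap',
    ← LinearMap.trace_conj' _ (Submodule.prodEquivOfIsCompl _ _ h)]
  congr 1
  ext v
  obtain ⟨⟨s, t⟩, rfl⟩ := (Submodule.prodEquivOfIsCompl _ _ h).surjective v
  simp [LinearEquiv.conj_apply, Subrepresentation.toRepresentation]

theorem simple_fdRep_of {G : Type} [Group G] [Fintype G] {V : Type} [AddCommGroup V] [Module ℂ V]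
    [FiniteDimensional ℂ V] (ρ : Representation ℂ G V) [IsIrreducible ρ] :
    Simple (FDRep.of ρ) := by
  have := invertibleOfNonzero (NeZero.ne (Nat.card G : ℂ))
  rw [FDRep.simple_iff_char_is_norm_one]
  have h := card_inv_mul_sum_char_mul_char_eq_finrank ρ ρ
  rw [IsIrreducible.finrank_intertwiningMap_self, Nat.cast_one,
    inv_mul_eq_one₀ (NeZero.ne _)] at h
  exact h.symm

theorem exists_character_eq_sum_simple {G : Type} [Group G] [Fintype G] (n : ℕ) {V : Type}
    [AddCommGroup V] [Module ℂ V] [FiniteDimensional ℂ V] (hn : Module.finrank ℂ V = n)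
    (ρ : Representation ℂ G V) :
    ∃ (ι : Type) (_ : Fintype ι) (W : ι → FDRep ℂ G), (∀ i, Simple (W i)) ∧
      ∀ g, ρ.character g = ∑ i, (W i).character g := by
  induction n using Nat.strong_induction_on generalizing V with
  | _ n ih =>
  by_cases hV : Subsingleton V
  · refine ⟨Empty, inferInstance, Empty.elim, fun i => i.elim, fun g => ?_⟩
    simp [character, Subsingleton.elim (ρ g) 0]
  by_cases hρ : IsIrreducible ρ
  · exact ⟨Unit, inferInstance, fun _ => FDRep.of ρ, fun _ => simple_fdRep_of ρ, fun g => by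
      simp only [Finset.univ_unique, Finset.sum_singleton]; rfl⟩
  have hnt : Nontrivial (Subrepresentation ρ) := by
    rw [not_subsingleton_iff_nontrivial] at hV
    exact ⟨⊥, ⊤, fun h => bot_ne_top (congrArg Subrepresentation.toSubmodule h)⟩
  obtain ⟨S, hS_bot, hS_top⟩ : ∃ S : Subrepresentation ρ, S ≠ ⊥ ∧ S ≠ ⊤ := by
    by_contra! hS
    exact hρ ⟨fun S => or_iff_not_imp_left.mpr (hS S)⟩
  obtain ⟨T, hST⟩ := exists_isCompl S
  have hT_top : T ≠ ⊤ := fun h => hS_bot (by simpa [h] using hST.inf_eq_bot)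
  have hlt (U : Subrepresentation ρ) (hU : U ≠ ⊤) : Module.finrank ℂ U.toSubmodule < n :=
    hn ▸ Submodule.finrank_lt fun h => hU (Subrepresentation.toSubmodule_injective h)
  obtain ⟨ι, _, W, hW, hWc⟩ := ih _ (hlt S hS_top) rfl S.toRepresentation
  obtain ⟨κ, _, X, hX, hXc⟩ := ih _ (hlt T hT_top) rfl T.toRepresentation
  have hcompl : IsCompl S.toSubmodule T.toSubmodule :=
    IsCompl.of_eq (congrArg Subrepresentation.toSubmodule hST.inf_eq_bot)
      (congrArg Subrepresentation.toSubmodule hST.sup_eq_top)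
  refine ⟨ι ⊕ κ, inferInstance, Sum.elim W X, Sum.rec hW hX, fun g => ?_⟩
  simp [character_eq_add_of_isCompl hcompl g, hWc, hXc]

end Representation

namespace FDRep

variable {G : Type} [Group G] [Fintype G]

theorem finrank_pos_of_simple (V : FDRep ℂ G) [hV : Simple V] : 0 < Module.finrank ℂ V := by
  rw [Nat.pos_iff_ne_zero]
  intro h
  have hsub : Subsingleton V := Module.finrank_zero_iff.mp h
  have hchar (g : G) : V.character g = 0 := by
    simp [character, Subsingleton.elim (V.ρ g) 0]
  have hnorm := (simple_iff_char_is_norm_one V).mp hV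
  simp only [hchar, mul_zero, Finset.sum_const_zero] at hnorm
  exact NeZero.ne (Nat.card G : ℂ) hnorm.symm

open scoped Classical in
theorem sum_character_of_simple (V : FDRep ℂ G) [Simple V] :
    ∑ g : G, V.character g = if ∀ g, V.character g = 1 then (Fintype.card G : ℂ) else 0 := by
  split_ifs with h
  · simp [h]
  have := invertibleOfNonzero (NeZero.ne (Nat.card G : ℂ))
  let E : FDRep ℂ G := of (Representation.trivial ℂ G ℂ)
  have hE (g : G) : E.character g = 1 := by
    change LinearMap.trace ℂ ℂ (Representation.trivial ℂ G ℂ g) = 1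
    rw [show Representation.trivial ℂ G ℂ g = 1 from rfl, LinearMap.trace_one]
    simp
  have : Simple E := by simp [simple_iff_char_is_norm_one, hE]
  have horth := char_orthonormal V E
  rw [if_neg fun ⟨i⟩ => h fun g => (congrFun (char_iso i) g).trans (hE g)] at horth
  simpa [hE] using horth

theorem sum_character_inv_mul_re_nonneg (V : FDRep ℂ G) (Y : Finset G) :
    0 ≤ (∑ x ∈ Y, ∑ y ∈ Y, V.character (x⁻¹ * y)).re :=
  (Complex.nonneg_iff.mp (Representation.sum_character_inv_mul_nonneg V.ρ Y)).1

end FDRep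

theorem sum_character_inv_mul_re_eq_of_dPar_div {G : Type} [Group G] [Fintype G] {Y : Finset G}
    (hY : Y.Nonempty) (V : FDRep ℂ G) [Simple V] {c : ℝ}
    (h : dPar V Y / (Module.finrank ℂ V : ℝ) = c) :
    (∑ x ∈ Y, ∑ y ∈ Y, V.character (x⁻¹ * y)).re =
      c ^ 2 * (Y.card : ℝ) ^ 2 * (Fintype.card G : ℝ) * (Module.finrank ℂ V : ℝ) := by
  have hd : (0 : ℝ) < Module.finrank ℂ V := by exact_mod_cast V.finrank_pos_of_simple
  have hYc : (0 : ℝ) < Y.card := by exact_mod_cast hY.card_pos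
  have hG : (0 : ℝ) < Fintype.card G := by exact_mod_cast Fintype.card_pos
  have hS := V.sum_character_inv_mul_re_nonneg Y
  rw [← h, dPar, div_pow, Real.sq_sqrt (by positivity)]
  field_simp

theorem sq_eq_of_forall_dPar_div_eq {G : Type} [Group G] [Fintype G] [Nontrivial G]
    {Y : Finset G} (hY : Y.Nonempty) {c : ℝ}
    (h : ∀ V : FDRep ℂ G, Simple V → ¬ (∀ g : G, V.character g = 1) →
      dPar V Y / (Module.finrank ℂ V : ℝ) = c) :
    c ^ 2 = (1 / (Y.card : ℝ) - 1 / (Fintype.card G : ℝ)) / ((Fintype.card G : ℝ) - 1) := by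
  classical
  obtain ⟨ι, _, W, hW, hchar⟩ :=
    Representation.exists_character_eq_sum_simple _ rfl (Representation.rightTranslation G)
  simp only [Representation.character_rightTranslation] at hchar
  have hYc : (0 : ℝ) < Y.card := by exact_mod_cast hY.card_pos
  have hG : (1 : ℝ) < Fintype.card G := by exact_mod_cast Fintype.one_lt_card
  let S (i : ι) := (∑ x ∈ Y, ∑ y ∈ Y, (W i).character (x⁻¹ * y)).re
  let K := c ^ 2 * (Y.card : ℝ) ^ 2 * (Fintype.card G : ℝ)
  have hdim : ∑ i, (Module.finrank ℂ (W i) : ℝ) = Fintype.card G := by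
    have h1 := hchar 1
    simp only [if_true, FDRep.char_one] at h1
    exact_mod_cast h1.symm
  have htriv : #{i | ∀ g, (W i).character g = 1} = 1 := by
    have hsum : ∑ g : G, ∑ i, (W i).character g = Fintype.card G := by
      simp [← hchar]
    rw [Finset.sum_comm] at hsum
    simp only [FDRep.sum_character_of_simple, ← Finset.sum_filter, Finset.sum_const,
      nsmul_eq_mul] at hsum
    have hGc : (Fintype.card G : ℂ) ≠ 0 := NeZero.ne _
    exact_mod_cast mul_right_cancel₀ hGc (hsum.trans (one_mul _).symm)
  have hS_sum : ∑ i, S i = Fintype.card G * Y.card := by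
    have hcomplex : ∑ i, ∑ x ∈ Y, ∑ y ∈ Y, (W i).character (x⁻¹ * y) =
        ((Fintype.card G * Y.card : ℝ) : ℂ) := by
      rw [Finset.sum_comm]
      simp only [Finset.sum_comm (s := Finset.univ), ← hchar, inv_mul_eq_one]
      simp [mul_comm]
    rw [← Complex.re_sum, hcomplex, Complex.ofReal_re]
  have hS_eq (i : ι) : S i = K * Module.finrank ℂ (W i) +
      if ∀ g, (W i).character g = 1 then (Y.card : ℝ) ^ 2 - K else 0 := by
    split_ifs with hi
    · have hd : Module.finrank ℂ (W i) = 1 := by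
        exact_mod_cast (FDRep.char_one (W i)).symm.trans (hi 1)
      simp [S, hi, hd, sq]
    · rw [add_zero]
      exact sum_character_inv_mul_re_eq_of_dPar_div hY (W i) (h _ (hW i) hi)
  simp only [hS_eq, Finset.sum_add_distrib, ← Finset.mul_sum, hdim, ← Finset.sum_filter,
    Finset.sum_const, htriv, one_smul, K] at hS_sum
  have hG' : (Fintype.card G : ℝ) - 1 ≠ 0 := by linarith
  field_simp
  refine mul_left_cancel₀ hYc.ne' ?_
  linear_combination hS_sum

theorem stmt6 {G : Type} [Group G] [Fintype G] [Nontrivial G]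
    (Y : Finset G) (hY : Y.Nonempty) :
    (∃ c : ℝ, ∀ V : FDRep ℂ G, Simple V → ¬ (∀ g : G, V.character g = 1) →
        dPar V Y / (Module.finrank ℂ V : ℝ) = c) ↔
      (∀ V : FDRep ℂ G, Simple V → ¬ (∀ g : G, V.character g = 1) →
        dPar V Y / (Module.finrank ℂ V : ℝ) =
          Real.sqrt ((1 / (Y.card : ℝ) - 1 / (Fintype.card G : ℝ)) /
            ((Fintype.card G : ℝ) - 1))) := by
  refine ⟨fun ⟨c, hc⟩ V hV hV_triv => ?_, fun h => ⟨_, h⟩⟩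
  rw [← sq_eq_of_forall_dPar_div_eq hY hc, hc V hV hV_triv, Real.sqrt_sq]
  rw [← hc V hV hV_triv]
  exact div_nonneg (Real.sqrt_nonneg _) (Nat.cast_nonneg _)
end

section
/- Let G be a nontrivial finite abelian group and Y a nonempty subset of G. Then the following are equivalent: (1) Y is a difference set in G or Y = G; (2) ∂_ρ(Y) is independent of the choice of the nontrivial irreducible complex character ρ of G; (3) D(Y) = √((1/#Y − 1/#G)/(#G − 1)). -/
open Finset

/-- `λ_a(Y) = #{(x,y) ∈ Y×Y : x⁻¹y = a}`. -/
def lamEl {G : Type} [Group G] [DecidableEq G] (Y : Finset G) (a : G) : ℕ :=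
  ((Y ×ˢ Y).filter (fun p => p.1⁻¹ * p.2 = a)).card

/-- A nonempty proper subset `Y ⊊ G` is a difference set if `λ_a(Y)` takes the same value
for all `a ≠ 1`. -/
def IsDiffSet {G : Type} [Group G] [Fintype G] [DecidableEq G] (Y : Finset G) : Prop :=
  Y.Nonempty ∧ Y ≠ Finset.univ ∧ ∃ c : ℕ, ∀ a : G, a ≠ 1 → lamEl Y a = c

/-- For a (one-dimensional) character `χ : G →* ℂ` of an abelian group,
`∂_χ(Y) = √( 1/((#Y)²·#G) · ∑_{x,y ∈ Y} χ(x⁻¹y) )`. -/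
noncomputable def dParChar {G : Type} [Group G] [Fintype G] (χ : G →* ℂ) (Y : Finset G) : ℝ :=
  Real.sqrt (1 / ((Y.card : ℝ) ^ 2 * (Fintype.card G : ℝ)) *
    (∑ x ∈ Y, ∑ y ∈ Y, χ (x⁻¹ * y)).re)

namespace MonoidHom

variable {G : Type} [CommGroup G]

/-- Complex characters of a commutative group `G`, written additively or multiplicatively. -/
def addCharEquiv : AddChar (Additive G) ℂ ≃ (G →* ℂ) :=
  AddChar.toMonoidHomEquiv (A := Additive G) (M := ℂ)

variable [Fintype G]

instance finite_complex : Finite (G →* ℂ) := .of_equiv _ addCharEquiv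

variable [Fintype (G →* ℂ)]

theorem card_complex : Fintype.card (G →* ℂ) = Fintype.card G := by
  rw [← Fintype.card_congr (addCharEquiv (G := G))]
  have := Fintype.ofFinite (Additive G)
  exact (AddChar.card_eq (α := Additive G)).trans (Fintype.card_congr Additive.toMul)

theorem sum_complex_apply [DecidableEq G] (a : G) :
    ∑ χ : G →* ℂ, χ a = if a = 1 then (Fintype.card G : ℂ) else 0 := by
  rw [← addCharEquiv.sum_comp]
  have := Fintype.ofFinite (Additive G)
  have hcard : Fintype.card (Additive G) = Fintype.card G := Fintype.card_congr Additive.toMul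
  rw [← hcard]
  exact AddChar.sum_apply_eq_ite (α := Additive G) (Additive.ofMul a)

omit [Fintype (G →* ℂ)] in
theorem apply_inv_eq_conj (χ : G →* ℂ) (x : G) : χ x⁻¹ = starRingEnd ℂ (χ x) := by
  have h : ‖χ x‖ = 1 := by
    refine Complex.norm_eq_one_of_pow_eq_one (n := Fintype.card G) ?_ Fintype.card_ne_zero
    rw [← map_pow, pow_card_eq_one, map_one]
  rw [← Complex.inv_eq_conj h]
  exact eq_inv_of_mul_eq_one_left (by rw [← map_mul, inv_mul_cancel, map_one])

end MonoidHom

section Energy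

variable {G : Type} [CommGroup G] [Fintype G]

theorem sum_sum_apply_inv_mul (χ : G →* ℂ) (Y : Finset G) :
    ∑ x ∈ Y, ∑ y ∈ Y, χ (x⁻¹ * y) = ((‖∑ y ∈ Y, χ y‖ ^ 2 : ℝ) : ℂ) := by
  rw [Complex.ofReal_pow, ← Complex.conj_mul', map_sum, Finset.sum_mul_sum]
  simp only [map_mul, χ.apply_inv_eq_conj]

theorem dParChar_sq (χ : G →* ℂ) (Y : Finset G) :
    dParChar χ Y ^ 2 =
      1 / ((Y.card : ℝ) ^ 2 * (Fintype.card G : ℝ)) * ‖∑ y ∈ Y, χ y‖ ^ 2 := by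
  rw [dParChar, sum_sum_apply_inv_mul, Complex.ofReal_re, Real.sq_sqrt (by positivity)]

theorem dParChar_nonneg (χ : G →* ℂ) (Y : Finset G) : 0 ≤ dParChar χ Y := Real.sqrt_nonneg _

/-- The value of `dParChar` determines the character sum. -/
theorem sum_sum_apply_eq_of_dParChar_eq {χ : G →* ℂ} {Y : Finset G} (hY : Y.Nonempty) {c : ℝ}
    (h : dParChar χ Y = c) :
    ∑ x ∈ Y, ∑ y ∈ Y, χ (x⁻¹ * y) =
      ((c ^ 2 * ((Y.card : ℝ) ^ 2 * Fintype.card G) : ℝ) : ℂ) := by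
  have hn : (Fintype.card G : ℝ) ≠ 0 := by simp
  have hk : (Y.card : ℝ) ≠ 0 := by simpa using hY.ne_empty
  rw [sum_sum_apply_inv_mul, ← h, dParChar_sq]
  congr 1
  field_simp

variable [DecidableEq G]

theorem sum_lamEl_mul (Y : Finset G) (f : G → ℂ) :
    ∑ a, (lamEl Y a : ℂ) * f a = ∑ x ∈ Y, ∑ y ∈ Y, f (x⁻¹ * y) := by
  rw [← Finset.sum_product' (f := fun x y => f (x⁻¹ * y)),
    ← Finset.sum_fiberwise (Y ×ˢ Y) (fun p => p.1⁻¹ * p.2)]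
  refine Finset.sum_congr rfl fun a _ => ?_
  rw [Finset.sum_congr rfl (g := fun _ => f a), Finset.sum_const, nsmul_eq_mul, lamEl]
  intro p hp
  rw [(Finset.mem_filter.mp hp).2]

omit [Fintype G] in
theorem lamEl_one (Y : Finset G) : lamEl Y 1 = Y.card := by
  rw [lamEl, ← Finset.diag_card Y]
  congr 1
  ext ⟨x, y⟩
  simp only [mem_filter, mem_product, mem_diag, inv_mul_eq_one]
  grind

theorem lamEl_univ (a : G) : lamEl (univ : Finset G) a = Fintype.card G := by
  rw [lamEl, ← Finset.card_univ]
  refine Finset.card_bij' (fun p _ => p.1) (fun x _ => (x, x * a)) ?_ ?_ ?_ ?_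
  · simp
  · simp
  · rintro ⟨x, y⟩ h
    simp only [mem_filter] at h
    simp [← h.2]
  · simp

theorem sum_sum_apply_of_lamEl_eq {Y : Finset G} {c : ℕ} (h : ∀ a : G, a ≠ 1 → lamEl Y a = c)
    {χ : G →* ℂ} (hχ : χ ≠ 1) : ∑ x ∈ Y, ∑ y ∈ Y, χ (x⁻¹ * y) = (Y.card : ℂ) - c := by
  classical
  have hs : ∑ a, χ a = 0 := by rw [sum_hom_units, if_neg hχ, Nat.cast_zero]
  have hd : ∀ a, (lamEl Y a : ℂ) * χ a = c * χ a + if a = 1 then (Y.card : ℂ) - c else 0 := by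
    intro a
    by_cases ha : a = 1
    · simp [ha, lamEl_one]
    · simp [ha, h a ha]
  rw [← sum_lamEl_mul, Finset.sum_congr rfl fun a _ => hd a, Finset.sum_add_distrib,
    ← Finset.mul_sum, hs]
  simp

theorem sum_apply_inv_mul_sum_sum [Fintype (G →* ℂ)] (Y : Finset G) (a : G) :
    ∑ χ : G →* ℂ, χ a⁻¹ * ∑ x ∈ Y, ∑ y ∈ Y, χ (x⁻¹ * y) = Fintype.card G * lamEl Y a := by
  simp_rw [← sum_lamEl_mul, Finset.mul_sum]
  rw [Finset.sum_comm]
  have (b : G) : ∑ χ : G →* ℂ, χ a⁻¹ * ((lamEl Y b : ℂ) * χ b) =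
      if a = b then (Fintype.card G : ℂ) * lamEl Y b else 0 := by
    simp_rw [mul_left_comm, ← map_mul, ← Finset.mul_sum, MonoidHom.sum_complex_apply,
      inv_mul_eq_one]
    split_ifs <;> ring
  simp_rw [this]
  simp

omit [DecidableEq G] in
theorem sum_dParChar_sq [Fintype {χ : G →* ℂ // χ ≠ 1}] {Y : Finset G} (hY : Y.Nonempty) :
    ∑ χ : {χ : G →* ℂ // χ ≠ 1}, dParChar χ.1 Y ^ 2 =
      1 / (Y.card : ℝ) - 1 / (Fintype.card G : ℝ) := by
  classical
  have := Fintype.ofFinite (G →* ℂ)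
  have hn : (Fintype.card G : ℝ) ≠ 0 := by simp
  have hk : (Y.card : ℝ) ≠ 0 := by simpa using hY.ne_empty
  have hall : ∑ χ : G →* ℂ, ‖∑ y ∈ Y, χ y‖ ^ 2 = (Fintype.card G : ℝ) * Y.card := by
    have := sum_apply_inv_mul_sum_sum Y 1
    simp only [inv_one, map_one, one_mul, sum_sum_apply_inv_mul, lamEl_one] at this
    exact_mod_cast this
  have hsplit := Fintype.sum_eq_add_sum_subtype_ne (fun χ : G →* ℂ => dParChar χ Y ^ 2) 1
  have h1 : ∑ χ : G →* ℂ, dParChar χ Y ^ 2 = 1 / (Y.card : ℝ) := by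
    simp_rw [dParChar_sq, ← Finset.mul_sum, hall]
    field_simp
  have h2 : dParChar (1 : G →* ℂ) Y ^ 2 = 1 / (Fintype.card G : ℝ) := by
    rw [dParChar_sq]
    simp
    field_simp
  rw [h1, h2] at hsplit
  rw [eq_sub_iff_add_eq', hsplit]
  congr!

omit [DecidableEq G] in
theorem card_nontrivial_characters [Fintype {χ : G →* ℂ // χ ≠ 1}] :
    (Fintype.card {χ : G →* ℂ // χ ≠ 1} : ℝ) = (Fintype.card G : ℝ) - 1 := by
  classical
  have := Fintype.ofFinite (G →* ℂ)
  have h := Fintype.card_subtype_compl (fun χ : G →* ℂ => χ = 1)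
  rw [Fintype.card_subtype_eq, MonoidHom.card_complex] at h
  rw [← Nat.cast_pred Fintype.card_pos, ← h]

theorem exists_dParChar_eq_iff_exists_lamEl_eq [Nontrivial G] {Y : Finset G} (hY : Y.Nonempty) :
    (∃ c : ℝ, ∀ χ : G →* ℂ, χ ≠ 1 → dParChar χ Y = c) ↔
      ∃ c : ℕ, ∀ a : G, a ≠ 1 → lamEl Y a = c := by
  classical
  have := Fintype.ofFinite (G →* ℂ)
  refine ⟨fun ⟨c, hc⟩ => ?_, fun ⟨c, hc⟩ => ?_⟩
  · obtain ⟨k, hk⟩ : ∃ k : ℂ, ∀ χ : G →* ℂ, χ ≠ 1 → ∑ x ∈ Y, ∑ y ∈ Y, χ (x⁻¹ * y) = k :=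
      ⟨_, fun χ hχ => sum_sum_apply_eq_of_dParChar_eq hY (hc χ hχ)⟩
    have key (a : G) (ha : a ≠ 1) : (Fintype.card G : ℂ) * lamEl Y a = (Y.card : ℂ) ^ 2 - k := by
      have hd (χ : G →* ℂ) : χ a⁻¹ * ∑ x ∈ Y, ∑ y ∈ Y, χ (x⁻¹ * y) =
          χ a⁻¹ * k + if χ = 1 then (Y.card : ℂ) ^ 2 - k else 0 := by
        by_cases hχ : χ = 1
        · simp [hχ, sq]
        · rw [hk χ hχ, if_neg hχ, add_zero]
      rw [← sum_apply_inv_mul_sum_sum, Finset.sum_congr rfl fun χ _ => hd χ, Finset.sum_add_distrib,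
        ← Finset.sum_mul, MonoidHom.sum_complex_apply, if_neg (inv_ne_one.mpr ha)]
      simp
    obtain ⟨b, hb⟩ := exists_ne (1 : G)
    refine ⟨lamEl Y b, fun a ha => ?_⟩
    have := (key a ha).trans (key b hb).symm
    exact_mod_cast mul_left_cancel₀ (by simp) this
  · refine ⟨Real.sqrt (1 / ((Y.card : ℝ) ^ 2 * (Fintype.card G : ℝ)) *
      ((Y.card : ℂ) - c).re), fun χ hχ => ?_⟩
    rw [dParChar, sum_sum_apply_of_lamEl_eq hc hχ]

end Energy

/-- A finite family of nonnegative reals is constant iff its supremum is the quadratic mean. -/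
theorem exists_eq_const_iff_iSup_eq_sqrt {ι : Type*} [Fintype ι] [Nonempty ι] {f : ι → ℝ}
    (hf : ∀ i, 0 ≤ f i) :
    (∃ c, ∀ i, f i = c) ↔ ⨆ i, f i = Real.sqrt ((∑ i, f i ^ 2) / Fintype.card ι) := by
  have hn : (Fintype.card ι : ℝ) ≠ 0 := by simp
  refine ⟨fun ⟨c, hc⟩ => ?_, fun h => ?_⟩
  · have hc0 : 0 ≤ c := hc (Classical.arbitrary ι) ▸ hf _
    simp only [hc, ciSup_const, Finset.sum_const, Finset.card_univ, nsmul_eq_mul]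
    rw [mul_div_cancel_left₀ _ hn, Real.sqrt_sq hc0]
  · refine ⟨⨆ i, f i, fun i => ?_⟩
    have hle : ∀ i, f i ≤ ⨆ i, f i := le_ciSup (Set.finite_range f).bddAbove
    have hsum : ∑ i, f i ^ 2 = ∑ _i : ι, (⨆ i, f i) ^ 2 := by
      rw [h, Real.sq_sqrt (by positivity), Finset.sum_const, Finset.card_univ, nsmul_eq_mul,
        mul_div_cancel₀ _ hn]
    have := (Finset.sum_eq_sum_iff_of_le
      fun i _ => pow_le_pow_left₀ (hf i) (hle i) 2).mp hsum i (Finset.mem_univ i)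
    exact (pow_left_inj₀ (hf i) ((hf i).trans (hle i)) two_ne_zero).mp this

theorem stmt9 {G : Type} [CommGroup G] [Fintype G] [DecidableEq G] [Nontrivial G]
    (Y : Finset G) (hY : Y.Nonempty) :
    ((IsDiffSet Y ∨ Y = Finset.univ) ↔
        ∃ c : ℝ, ∀ χ : G →* ℂ, χ ≠ 1 → dParChar χ Y = c) ∧
    ((∃ c : ℝ, ∀ χ : G →* ℂ, χ ≠ 1 → dParChar χ Y = c) ↔
        (⨆ χ : {χ : G →* ℂ // χ ≠ 1}, dParChar χ.1 Y) =
          Real.sqrt ((1 / (Y.card : ℝ) - 1 / (Fintype.card G : ℝ)) /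
            ((Fintype.card G : ℝ) - 1))) := by
  constructor
  · rw [exists_dParChar_eq_iff_exists_lamEl_eq hY]
    constructor
    · rintro (h | rfl)
      · exact h.2.2
      · exact ⟨_, fun a _ => lamEl_univ a⟩
    · intro h
      by_cases hu : Y = univ
      · exact .inr hu
      · exact .inl ⟨hY, hu, h⟩
  · have := Fintype.ofFinite {χ : G →* ℂ // χ ≠ 1}
    have : Nonempty {χ : G →* ℂ // χ ≠ 1} := by
      rw [← Fintype.card_pos_iff, ← Nat.cast_pos (α := ℝ), card_nontrivial_characters, sub_pos]
      exact_mod_cast Fintype.one_lt_card (α := G)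
    rw [← sum_dParChar_sq hY, ← card_nontrivial_characters,
      ← exists_eq_const_iff_iSup_eq_sqrt (f := fun χ : {χ : G →* ℂ // χ ≠ 1} => dParChar χ.1 Y)
        fun χ => dParChar_nonneg χ.1 Y]
    simp only [Subtype.forall]
end
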